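/- Let n ≥ 1, let D > 1, let λ ≥ log D, let ε > 0, and let a, b > 0. Suppose (A_m)_{m≥0} is a sequence of subsets of ℝ^{2n} and (U_m)_{m≥0} is a sequence of measurable subsets of ℝ^{2n} such that for every m: (I) U_m contains the closed a·e^{−m(λ+ε)}-neighborhood {z : dist(z, A_m) ≤ a·e^{−m(λ+ε)}} of A_m, and (II) Vol(U_m) ≤ b·D^m·e^{−m(2λ−ε)}. Then every set Y ⊆ ℝ^{2n} with Y ⊆ ⋃_{m≥l} A_m for all l ≥ 0 has Hausdorff dimension at most 2n − 2 + (log D)/λ + 4ε/λ. -/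

import Mathlib

open MeasureTheory

open Filter Topology Metric Set in
/-- A Borel–Cantelli lemma for Hausdorff measures: the set of points lying in infinitely many
members of a countable family with summable `d`-th powers of diameters is `μH[d]`-null. -/
theorem hausdorffMeasure_eq_zero_of_tsum_ediam_rpow_ne_top {X ι : Type*} [EMetricSpace X]
    [MeasurableSpace X] [BorelSpace X] [Countable ι] {d : ℝ} (hd : 0 < d) {S : ι → Set X}
    (hS : ∑' i, ediam (S i) ^ d ≠ ⊤) {Y : Set X} (hY : ∀ y ∈ Y, {i | y ∈ S i}.Infinite) :
    μH[d] Y = 0 := by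
  have htail := ENNReal.tendsto_tsum_compl_atTop_zero hS
  refine le_antisymm ?_ zero_le
  rw [← htail.liminf_eq]
  refine Measure.hausdorffMeasure_le_liminf_tsum (ι := fun F : Finset ι => {i // i ∉ F}) d Y
    (fun F => (∑' i : {i // i ∉ F}, ediam (S i) ^ d) ^ (1 / d)) ?_ (fun F i => S i) ?_ ?_
  · have h := (ENNReal.continuous_rpow_const (y := 1 / d)).tendsto 0 |>.comp htail
    rwa [ENNReal.zero_rpow_of_pos (by positivity)] at h
  · refine Eventually.of_forall fun F i => ?_
    rw [one_div, ENNReal.le_rpow_inv_iff hd]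
    exact ENNReal.le_tsum (f := fun i : {i // i ∉ F} => ediam (S i) ^ d) i
  · refine Eventually.of_forall fun F y hy => ?_
    obtain ⟨i, hi, hiF⟩ := (hY y hy).exists_notMem_finset F
    exact mem_iUnion.2 ⟨⟨i, hiF⟩, hi⟩

open Metric Set Function in
/-- A set whose `r`-neighborhood is contained in `U` can be covered by balls of radius `4 * r`
in such a way that the number of balls times the volume of an `r`-ball is at most the volume
of `U`. -/
theorem exists_countable_cover_tsum_measure_closedBall_le {E : Type*} [NormedAddCommGroup E]
    [NormedSpace ℝ E] [FiniteDimensional ℝ E] [MeasurableSpace E] [BorelSpace E]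
    (μ : Measure E) [μ.IsAddHaarMeasure] {A U : Set E} {r : ℝ} (hr : 0 < r)
    (hAU : ∀ x ∈ A, closedBall x r ⊆ U) :
    ∃ t : Set E, t.Countable ∧ A ⊆ ⋃ x ∈ t, closedBall x (4 * r) ∧
      ∑' _ : t, μ (closedBall (0 : E) r) ≤ μ U := by
  obtain ⟨t, htA, hdisj, hcov⟩ := Vitali.exists_disjoint_subfamily_covering_enlargement_closedBall
    A (fun x : E => x) (fun _ => r) r (fun _ _ => le_rfl) 4 (by norm_num)
  refine ⟨t, hdisj.countable_of_nonempty_interior fun x _ => ?_, fun x hx => ?_, ?_⟩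
  · exact ⟨x, ball_subset_interior_closedBall (mem_ball_self hr)⟩
  · obtain ⟨y, hy, hxy⟩ := hcov x hx
    exact mem_biUnion hy (hxy (mem_closedBall_self hr.le))
  · calc ∑' _ : t, μ (closedBall (0 : E) r)
        = ∑' x : t, μ (closedBall (x : E) r) := by
          simp only [Measure.addHaar_closedBall_center μ _ r]
      _ ≤ μ (⋃ x : t, closedBall (x : E) r) :=
          tsum_meas_le_meas_iUnion_of_disjoint μ (fun _ => measurableSet_closedBall)
            (hdisj.subtype _ _)
      _ ≤ μ U := measure_mono (iUnion_subset fun x => hAU x (htA x.2))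

/-- If the `r m`-neighborhood of `A m` lies in `U m`, and `r m ^ d` times the volume of `U m`
measured in `r m`-balls is summable, then the set of points lying in infinitely many `A m` is
`μH[d]`-null. -/
theorem hausdorffMeasure_eq_zero_of_tsum_measure_neighborhood_ne_top {E : Type*}
    [NormedAddCommGroup E] [NormedSpace ℝ E] [FiniteDimensional ℝ E] [MeasurableSpace E]
    [BorelSpace E] (μ : Measure E) [μ.IsAddHaarMeasure] {d : ℝ} (hd : 0 < d) {A U : ℕ → Set E}
    {r : ℕ → ℝ} (hr : ∀ m, 0 < r m) (hAU : ∀ m, ∀ x ∈ A m, Metric.closedBall x (r m) ⊆ U m)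
    (hsum : ∑' m, ENNReal.ofReal (8 * r m) ^ d / μ (Metric.closedBall 0 (r m)) * μ (U m) ≠ ⊤)
    {Y : Set E} (hY : ∀ y ∈ Y, {m | y ∈ A m}.Infinite) :
    μH[d] Y = 0 := by
  choose t htc hcov hvol using fun m =>
    exists_countable_cover_tsum_measure_closedBall_le μ (hr m) (hAU m)
  have (m : ℕ) : Countable (t m) := (htc m).to_subtype
  refine hausdorffMeasure_eq_zero_of_tsum_ediam_rpow_ne_top (ι := Σ m, t m) hd
    (S := fun p => Metric.closedBall (p.2 : E) (4 * r p.1)) (ne_top_of_le_ne_top hsum ?_) ?_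
  · rw [ENNReal.tsum_sigma']
    refine ENNReal.tsum_le_tsum fun m => ?_
    have hpos : μ (Metric.closedBall 0 (r m)) ≠ 0 := (Metric.measure_closedBall_pos μ 0 (hr m)).ne'
    have hfin : μ (Metric.closedBall 0 (r m)) ≠ ⊤ := measure_closedBall_lt_top.ne
    have hdiam (x : t m) :
        Metric.ediam (Metric.closedBall (x : E) (4 * r m)) ≤ ENNReal.ofReal (8 * r m) := by
      rw [← Metric.closedEBall_ofReal (by linarith [hr m])]
      refine Metric.ediam_closedEBall_le.trans_eq ?_
      rw [← ENNReal.ofReal_ofNat 2, ← ENNReal.ofReal_mul (by norm_num)]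
      ring_nf
    calc ∑' x : t m, Metric.ediam (Metric.closedBall (x : E) (4 * r m)) ^ d
        ≤ ∑' _ : t m, ENNReal.ofReal (8 * r m) ^ d / μ (Metric.closedBall 0 (r m)) *
            μ (Metric.closedBall 0 (r m)) := by
          refine ENNReal.tsum_le_tsum fun x => ?_
          rw [ENNReal.div_mul_cancel hpos hfin]
          exact ENNReal.rpow_le_rpow (hdiam x) hd.le
      _ ≤ _ := by
          rw [ENNReal.tsum_mul_left]
          gcongr
          exact hvol m
  · intro y hy
    refine Set.Infinite.of_image Sigma.fst ((hY y hy).mono fun m hm => ?_)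
    obtain ⟨x, hx, hyx⟩ := Set.mem_iUnion₂.1 (hcov m hm)
    exact ⟨⟨m, x, hx⟩, hyx, rfl⟩

/-- The covering argument of the main theorem: if each `A_m` has a measurable "blanket"
`U_m` containing its closed `a·e^{−m(λ+ε)}`-neighborhood and of volume at most
`b·D^m·e^{−m(2λ−ε)}`, with `λ ≥ log D`, `D > 1`, then any `Y ⊆ ℝ^{2n}` contained in
`⋃_{m≥l} A_m` for every `l` has Hausdorff dimension at most
`2n − 2 + (log D)/λ + 4ε/λ`. -/
theorem dimH_le_of_neighborhood_volume_decay
    (n : ℕ) (hn : 1 ≤ n) (D : ℝ) (hD : 1 < D)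
    (lam : ℝ) (hlam : Real.log D ≤ lam)
    (ε : ℝ) (hε : 0 < ε) (a b : ℝ) (ha : 0 < a) (hb : 0 < b)
    (A U : ℕ → Set (EuclideanSpace ℝ (Fin (2 * n))))
    (hUmeas : ∀ m, MeasurableSet (U m))
    (hI : ∀ m : ℕ,
      {z | Metric.infDist z (A m) ≤ a * Real.exp (-(m * (lam + ε)))} ⊆ U m)
    (hII : ∀ m : ℕ,
      volume (U m) ≤ ENNReal.ofReal (b * D ^ m * Real.exp (-(m * (2 * lam - ε)))))
    (Y : Set (EuclideanSpace ℝ (Fin (2 * n))))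
    (hY : ∀ l : ℕ, Y ⊆ ⋃ m, ⋃ (_ : l ≤ m), A m) :
    dimH Y ≤ ENNReal.ofReal (2 * (n : ℝ) - 2 + Real.log D / lam + 4 * ε / lam) := by
  have hL : 0 < Real.log D := Real.log_pos hD
  have hlam0 : 0 < lam := hL.trans_le hlam
  have hn' : (1 : ℝ) ≤ n := by exact_mod_cast hn
  set s : ℝ := 2 * (n : ℝ) - 2 + Real.log D / lam + 4 * ε / lam with hs
  have hs0 : 0 < s := by
    have : 0 < Real.log D / lam := by positivity
    have : 0 < 4 * ε / lam := by positivity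
    linarith
  set r : ℕ → ℝ := fun m => a * Real.exp (-(m * (lam + ε))) with hr
  have hr0 (m : ℕ) : 0 < r m := by positivity
  set c : ENNReal := volume (Metric.closedBall (0 : EuclideanSpace ℝ (Fin (2 * n))) 1) with hc
  have hc0 : c ≠ 0 := (Metric.measure_closedBall_pos volume 0 one_pos).ne'
  have hct : c ≠ ⊤ := measure_closedBall_lt_top.ne
  have hcr : 0 < c.toReal := ENNReal.toReal_pos hc0 hct
  set δ : ℝ := ε + ε * Real.log D / lam + 4 * ε ^ 2 / lam with hδ
  have hδ0 : 0 < δ := by positivity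
  set K : ℝ := (8 * a) ^ s / (a ^ (2 * n) * c.toReal) * b with hK
  have hexp : -(s * (lam + ε)) + 2 * n * (lam + ε) + Real.log D - (2 * lam - ε) = -δ := by
    rw [hs, hδ]
    field_simp
    ring
  have hterm (m : ℕ) : (8 * r m) ^ s / (r m ^ (2 * n) * c.toReal) *
      (b * D ^ m * Real.exp (-(m * (2 * lam - ε)))) = K * Real.exp (-δ) ^ m := by
    have h1 : (8 * r m) ^ s = (8 * a) ^ s * Real.exp (-(m * (lam + ε)) * s) := by
      rw [hr, ← mul_assoc, Real.mul_rpow (by positivity) (by positivity), ← Real.exp_mul]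
    have h2 : r m ^ (2 * n) = a ^ (2 * n) * Real.exp (-(m * (lam + ε)) * (2 * n)) := by
      rw [hr, mul_pow, ← Real.exp_nat_mul]
      push_cast
      ring_nf
    have h3 : D ^ m = Real.exp (m * Real.log D) := by
      rw [Real.exp_nat_mul, Real.exp_log (by linarith)]
    have h4 : Real.exp (-δ) ^ m = Real.exp (-(m * (lam + ε)) * s) *
        (Real.exp (-(m * (lam + ε)) * (2 * n)))⁻¹ * Real.exp (m * Real.log D) *
        Real.exp (-(m * (2 * lam - ε))) := by
      rw [← Real.exp_neg, ← Real.exp_add, ← Real.exp_add, ← Real.exp_add, ← Real.exp_nat_mul,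
        ← hexp]
      ring_nf
    rw [h1, h2, h3, h4, hK]
    field_simp
  have hnull : μH[s] Y = 0 := by
    refine hausdorffMeasure_eq_zero_of_tsum_measure_neighborhood_ne_top volume hs0 (U := U) hr0
      (fun m x hx z hz => hI m ?_) (ne_top_of_le_ne_top ?_ (ENNReal.tsum_le_tsum
        (g := fun m => ENNReal.ofReal (K * Real.exp (-δ) ^ m)) fun m => ?_)) (A := A) ?_
    · exact (Metric.infDist_le_dist_of_mem hx).trans hz
    · refine Summable.tsum_ofReal_ne_top ?_
      exact (summable_geometric_of_lt_one (Real.exp_nonneg _)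
        (Real.exp_lt_one_iff.2 (by linarith))).mul_left K
    · rw [Measure.addHaar_closedBall' _ _ (hr0 m).le, finrank_euclideanSpace_fin, ← hc,
        ← ENNReal.ofReal_toReal hct, ENNReal.ofReal_rpow_of_pos (by linarith [hr0 m]),
        ← ENNReal.ofReal_mul (pow_nonneg (hr0 m).le _),
        ← ENNReal.ofReal_div_of_pos (mul_pos (pow_pos (hr0 m) _) hcr), ← hterm,
        ENNReal.ofReal_mul (by have := hr0 m; positivity)]
      gcongr
      exact hII m
    · intro y hy
      refine Set.infinite_of_forall_exists_gt fun l => ?_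
      obtain ⟨m, hlm, hm⟩ := Set.mem_iUnion₂.1 (hY (l + 1) hy)
      exact ⟨m, hm, Nat.lt_of_succ_le hlm⟩
  refine dimH_le_of_hausdorffMeasure_ne_top (d := s.toNNReal) ?_
  rw [Real.coe_toNNReal s hs0.le, hnull]
  exact ENNReal.zero_ne_top
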